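/- Let 1 < γ < 3 and λ ≥ α(γ−1)/(γ−3). Suppose the initial data (τ₀,u₀) ∈ C¹(ℝ) satisfy ‖u₀‖_{C¹} ≤ C₀, ‖τ₀‖_{C¹} ≤ C₀ and C₀⁻¹ < τ₀(x) for all x, for some constant C₀ > 0, and let (τ,u) be a C¹ solution of the system on ℝ × [0,∞). If there exists a point x₀ such that u_x(x₀,0) + φ_x(x₀,0) < −(α(γ−1)/(K_c(3−γ))) · φ(x₀,0)^{−2/(γ−1)}, or u_x(x₀,0) − φ_x(x₀,0) < −(α(γ−1)/(K_c(3−γ))) · φ(x₀,0)^{−2/(γ−1)}, then ‖(τ_x,u_x)‖_{L∞} blows up in finite time. -/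

import Mathlib

open Real Set MeasureTheory

/-- Partial derivative in the space variable `x`. -/
noncomputable def pdx (f : ℝ → ℝ → ℝ) (x t : ℝ) : ℝ := deriv (fun y => f y t) x

/-- Partial derivative in the time variable `t`. -/
noncomputable def pdt (f : ℝ → ℝ → ℝ) (x t : ℝ) : ℝ := deriv (fun s => f x s) t

/-- `(τ, u)` is a `C¹` solution of the compressible Euler equations with
time-dependent damping `τ_t - u_x = 0`, `u_t + p_x = -(α/(1+t)^λ) u`,
`p = K τ^{-γ}`, on `ℝ × [0,∞)`. -/
def IsSol (K γ α lam : ℝ) (τ u : ℝ → ℝ → ℝ) : Prop :=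
  ContDiff ℝ 1 (fun p : ℝ × ℝ => τ p.1 p.2) ∧
  ContDiff ℝ 1 (fun p : ℝ × ℝ => u p.1 p.2) ∧
  (∀ x t, 0 ≤ t → 0 < τ x t) ∧
  (∀ x t, 0 ≤ t → pdt τ x t = pdx u x t) ∧
  (∀ x t, 0 ≤ t →
    pdt u x t + pdx (fun y s => K * τ y s ^ (-γ)) x t = -(α / (1 + t) ^ lam) * u x t)

/-- `φ = (2√(Kγ)/(γ-1)) τ^{-(γ-1)/2}`. -/
noncomputable def Phi (K γ : ℝ) (τ : ℝ → ℝ → ℝ) (x t : ℝ) : ℝ :=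
  (2 * Real.sqrt (K * γ) / (γ - 1)) * τ x t ^ (-(γ - 1) / 2)

/-- `K_τ = (2√(Kγ)/(γ-1))^{2/(γ-1)}`. -/
noncomputable def Ktau (K γ : ℝ) : ℝ := (2 * Real.sqrt (K * γ) / (γ - 1)) ^ (2 / (γ - 1))

/-- `K_c = √(Kγ) K_τ^{-(γ+1)/2}`. -/
noncomputable def Kc (K γ : ℝ) : ℝ := Real.sqrt (K * γ) * Ktau K γ ^ (-(γ + 1) / 2)

/-- Blow-up of `‖(τ_x, u_x)‖_{L^∞}` in finite time. -/
def BlowsUp (τ u : ℝ → ℝ → ℝ) : Prop :=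
  ∃ T > (0 : ℝ),
    ¬ BddAbove {r : ℝ | ∃ x t, 0 ≤ t ∧ t ≤ T ∧ r = |pdx τ x t| + |pdx u x t|}

open Filter Topology

/-- A function whose values on `(t - ε, t]` are maximal at `t` has nonnegative derivative at `t`. -/
lemma nonneg_of_hasDerivAt_of_left_max {k : ℝ → ℝ} {k' s t : ℝ} (hst : s < t)
    (hk : HasDerivAt k k' t) (hmax : ∀ r ∈ Ioo s t, k r ≤ k t) : 0 ≤ k' := by
  have h := (hasDerivAt_iff_tendsto_slope.1 hk).mono_left
    (nhdsWithin_mono t (fun r (hr : r < t) => ne_of_lt hr) : 𝓝[<] t ≤ 𝓝[≠] t)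
  refine ge_of_tendsto h ?_
  filter_upwards [Ioo_mem_nhdsLT hst] with r hr
  rw [slope_def_field]
  exact div_nonneg_of_nonpos (by linarith [hmax r hr]) (by linarith [hr.2])

/-- Maximum principle on a strip for functions that are touched from below by solutions of a
transport inequality with speed at most `L`. -/
lemma le_of_transport_touching {g : ℝ → ℝ → ℝ} {A B L M T : ℝ} (hL : 0 ≤ L) (hM : 0 ≤ M)
    (hg : ContinuousOn (fun p : ℝ × ℝ => g p.1 p.2) (univ ×ˢ Icc 0 T))
    (hgrow : ∀ x, ∀ t ∈ Icc 0 T, g x t ≤ A + M * |x|)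
    (h0 : ∀ x, g x 0 ≤ B)
    (htouch : ∀ x, ∀ t ∈ Ioc 0 T, ∃ (h : ℝ → ℝ → ℝ) (hx ht : ℝ),
      (∀ y, ∀ s ∈ Icc 0 T, h y s ≤ g y s) ∧ h x t = g x t ∧
      HasDerivAt (fun y => h y t) hx x ∧ HasDerivAt (fun s => h x s) ht t ∧ ht ≤ L * |hx|) :
    ∀ x, ∀ t ∈ Icc 0 T, g x t ≤ B := by
  by_contra! hcon
  obtain ⟨x₁, t₁, ht₁, hlt⟩ := hcon
  set ε := (g x₁ t₁ - B) / (exp ((L + 1) * t₁) * (1 + x₁ ^ 2)) with hε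
  have hεpos : 0 < ε := div_pos (by linarith) (by positivity)
  have hcont : Continuous (fun p : ℝ × ℝ => B + ε * (exp ((L + 1) * p.2) * (1 + p.1 ^ 2))) := by
    fun_prop
  set ψ : ℝ → ℝ → ℝ := fun x t => B + ε * (exp ((L + 1) * t) * (1 + x ^ 2)) with hψ
  have hψcont : Continuous (fun p : ℝ × ℝ => ψ p.1 p.2) := hcont
  set S : Set (ℝ × ℝ) := {p ∈ univ ×ˢ Icc 0 T | ψ p.1 p.2 ≤ g p.1 p.2} with hS
  have hSclosed : IsClosed S :=
    IsClosed.isClosed_le (isClosed_univ.prod isClosed_Icc) hψcont.continuousOn hg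
  have hSsub : S ⊆ Icc (-((M + |A - B|) / ε + 1)) ((M + |A - B|) / ε + 1) ×ˢ Icc 0 T := by
    rintro ⟨x, t⟩ ⟨⟨-, ht⟩, hle⟩
    refine ⟨abs_le.1 ?_, ht⟩
    simp only at ht hle ⊢
    have h1 : 1 ≤ exp ((L + 1) * t) := one_le_exp (mul_nonneg (by linarith) ht.1)
    have h2 := hgrow x t ht
    have h3 : ε * (1 + x ^ 2) ≤ A - B + M * |x| := by
      have : ε * (1 + x ^ 2) ≤ ε * (exp ((L + 1) * t) * (1 + x ^ 2)) := by
        gcongr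
        nlinarith [sq_nonneg x]
      simp only [hψ] at hle
      linarith
    by_contra! hbig
    have h4 : 1 ≤ |x| := by
      have : 0 ≤ (M + |A - B|) / ε := by positivity
      linarith
    have h5 : M + |A - B| < ε * |x| := by
      have : (M + |A - B|) / ε < |x| := by linarith
      rw [div_lt_iff₀ hεpos] at this
      linarith
    have h6 := le_abs_self (A - B)
    have h7 : ε * |x| ^ 2 ≤ |A - B| + M * |x| := by
      rw [sq_abs]; linarith
    nlinarith [abs_nonneg (A - B)]
  have hScomp : IsCompact S := (isCompact_Icc.prod isCompact_Icc).of_isClosed_subset hSclosed hSsub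
  have hSne : S.Nonempty := by
    refine ⟨(x₁, t₁), ⟨trivial, ht₁⟩, ?_⟩
    have : ε * (exp ((L + 1) * t₁) * (1 + x₁ ^ 2)) = g x₁ t₁ - B := by
      rw [hε]; field_simp
    simp only [hψ]
    linarith
  obtain ⟨⟨x, t⟩, ⟨⟨-, ht⟩, hge⟩, hmin⟩ := hScomp.exists_isMinOn hSne continuous_snd.continuousOn
  simp only at ht hge
  have hbefore : ∀ y, ∀ s ∈ Ico 0 t, g y s < ψ y s := by
    intro y s hs
    by_contra! hc
    have : t ≤ s := hmin (show (y, s) ∈ S from ⟨⟨trivial, hs.1, by linarith [hs.2, ht.2]⟩, hc⟩)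
    linarith [hs.2]
  have hBlt : ∀ y s, B < ψ y s := fun y s => by
    have : 0 < ε * (exp ((L + 1) * s) * (1 + y ^ 2)) := by positivity
    simp only [hψ]
    linarith
  have htpos : 0 < t := by
    rcases ht.1.eq_or_lt with h | h
    · rw [← h] at hge
      linarith [h0 x, hBlt x 0]
    · exact h
  have hat : ∀ y, g y t ≤ ψ y t := by
    intro y
    have hc1 : ContinuousWithinAt (fun s => g y s) (Icc 0 T) t :=
      (hg (y, t) ⟨trivial, ht⟩).comp (f := fun s : ℝ => (y, s)) (by fun_prop)
        (fun s hs => ⟨trivial, hs⟩)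
    have hc2 : Tendsto (fun s => g y s) (𝓝[<] t) (𝓝 (g y t)) := by
      rw [← nhdsWithin_Ioo_eq_nhdsLT htpos]
      exact hc1.mono fun s hs => ⟨hs.1.le, by linarith [hs.2, ht.2]⟩
    have hc3 : Tendsto (fun s => ψ y s) (𝓝[<] t) (𝓝 (ψ y t)) :=
      ((hψcont.comp (by fun_prop : Continuous fun s : ℝ => (y, s))).tendsto t).mono_left
        nhdsWithin_le_nhds
    refine le_of_tendsto_of_tendsto hc2 hc3 ?_
    filter_upwards [Ioo_mem_nhdsLT htpos] with s hs
    exact (hbefore y s ⟨hs.1.le, hs.2⟩).le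
  obtain ⟨h, hx, htt, hle, heq, hdx, hdt, hineq⟩ := htouch x t ⟨htpos, ht.2⟩
  have htop : h x t = ψ x t := heq.trans (le_antisymm (hat x) hge)
  have hψx : HasDerivAt (fun y => ψ y t) (ε * (exp ((L + 1) * t) * (2 * x))) x := by
    have := ((((hasDerivAt_id x).pow 2).const_add 1).const_mul
      (exp ((L + 1) * t))).const_mul ε |>.const_add B
    exact this.congr_deriv (by simp)
  have hψt : HasDerivAt (fun s => ψ x s)
      (ε * (exp ((L + 1) * t) * (L + 1) * (1 + x ^ 2))) t := by
    have := ((((hasDerivAt_id t).const_mul (L + 1)).exp.mul_const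
      (1 + x ^ 2)).const_mul ε).const_add B
    exact this.congr_deriv (by simp)
  have ex : hx = ε * (exp ((L + 1) * t) * (2 * x)) := by
    have hloc : IsLocalMax (fun y => h y t - ψ y t) x := by
      refine Eventually.of_forall fun y => ?_
      have h1 := hle y t ht
      have h2 := hat y
      simp only
      linarith
    linarith [hloc.hasDerivAt_eq_zero (hdx.sub hψx)]
  have et : ε * (exp ((L + 1) * t) * (L + 1) * (1 + x ^ 2)) ≤ htt := by
    have := nonneg_of_hasDerivAt_of_left_max htpos (hdt.sub hψt) (fun s hs => by
      have h1 := hle x s ⟨hs.1.le, by linarith [hs.2, ht.2]⟩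
      have h2 := hbefore x s ⟨hs.1.le, hs.2⟩
      simp only [Pi.sub_apply]
      linarith)
    linarith
  have hE : 0 < ε * exp ((L + 1) * t) := by positivity
  have habs : |hx| ≤ ε * exp ((L + 1) * t) * (1 + x ^ 2) := by
    rw [ex, ← mul_assoc, abs_mul, abs_of_pos hE]
    gcongr
    rw [abs_le]
    constructor <;> nlinarith [sq_nonneg (x - 1), sq_nonneg (x + 1)]
  have := mul_le_mul_of_nonneg_left habs hL
  have : 0 < ε * exp ((L + 1) * t) * (1 + x ^ 2) := by positivity
  nlinarith

/-- Global existence of integral curves of a bounded, uniformly Lipschitz velocity field. -/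
lemma exists_integralCurve {c : ℝ → ℝ → ℝ} {T L M t₀ x₀ : ℝ} (ht₀ : t₀ ∈ Icc 0 T)
    (hc : ContinuousOn (fun p : ℝ × ℝ => c p.1 p.2) (univ ×ˢ Icc 0 T))
    (hbd : ∀ x, ∀ t ∈ Icc 0 T, |c x t| ≤ L)
    (hlip : ∀ t ∈ Icc 0 T, ∀ x y, |c x t - c y t| ≤ M * |x - y|) :
    ∃ X : ℝ → ℝ, X t₀ = x₀ ∧ ContinuousOn X (Icc 0 T) ∧
      ∀ t ∈ Ioo 0 T, HasDerivAt X (c (X t) t) t := by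
  have hL : 0 ≤ L := (abs_nonneg _).trans (hbd 0 t₀ ht₀)
  have hT : 0 ≤ T := ht₀.1.trans ht₀.2
  have hP : IsPicardLindelof (fun t x => c x t) (⟨t₀, ht₀⟩ : Icc 0 T) x₀
      (L * T).toNNReal 0 L.toNNReal M.toNNReal := by
    refine ⟨fun t ht => ?_, fun x _ => ?_, fun t ht x _ => ?_, ?_⟩
    · refine LipschitzOnWith.of_dist_le_mul fun x _ y _ => ?_
      rw [Real.dist_eq, Real.dist_eq]
      exact (hlip t ht x y).trans (by gcongr; exact le_coe_toNNReal M)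
    · exact hc.comp (f := fun t : ℝ => (x, t)) (by fun_prop) (fun t ht => ⟨trivial, ht⟩)
    · exact (hbd x t ht).trans (le_coe_toNNReal L)
    · simp only [NNReal.coe_zero, sub_zero, coe_toNNReal _ hL, coe_toNNReal _ (mul_nonneg hL hT)]
      gcongr
      exact max_le (by linarith [ht₀.1]) ht₀.2
  obtain ⟨X, hX0, hX⟩ := hP.exists_eq_forall_mem_Icc_hasDerivWithinAt₀
  exact ⟨X, hX0, fun t ht => (hX t ht).continuousWithinAt, fun t ht =>
    (hX t ⟨ht.1.le, ht.2.le⟩).hasDerivAt (Icc_mem_nhds ht.1 ht.2)⟩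

lemma abs_sub_le_of_hasDerivAt {f f' : ℝ → ℝ} {M : ℝ} (hf : ∀ x, HasDerivAt f (f' x) x)
    (hM : ∀ x, |f' x| ≤ M) (x y : ℝ) : |f x - f y| ≤ M * |x - y| :=
  convex_univ.norm_image_sub_le_of_norm_hasDerivWithin_le
    (fun z _ => (hf z).hasDerivWithinAt) (fun z _ => hM z) (mem_univ y) (mem_univ x)

/-- If `s` is a `C¹` solution of `s_t + c s_x = f`, then `s_x` is differentiable along
characteristics, with derivative `f_x - c_x s_x`, although `s` may fail to be `C²`. -/
lemma hasDerivAt_spatialDeriv_along {s c f sx cx fx : ℝ → ℝ → ℝ} {X : ℝ → ℝ} {T M : ℝ}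
    (hX : ContinuousOn X (Icc 0 T))
    (htrans : ∀ h, ∀ t ∈ Ioo 0 T, HasDerivAt (fun r => s (X r + h) r)
      (f (X t + h) t + (c (X t) t - c (X t + h) t) * sx (X t + h) t) t)
    (hsx : ∀ t ∈ Icc 0 T, ∀ x, HasDerivAt (fun y => s y t) (sx x t) x)
    (hcx : ∀ t ∈ Icc 0 T, ∀ x, HasDerivAt (fun y => c y t) (cx x t) x)
    (hfx : ∀ t ∈ Icc 0 T, ∀ x, HasDerivAt (fun y => f y t) (fx x t) x)
    (hsM : ∀ t ∈ Icc 0 T, ∀ x, |sx x t| ≤ M)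
    (hcM : ∀ t ∈ Icc 0 T, ∀ x, |cx x t| ≤ M)
    (hfM : ∀ t ∈ Icc 0 T, ∀ x, |fx x t| ≤ M)
    (hs : ContinuousOn (fun p : ℝ × ℝ => s p.1 p.2) (univ ×ˢ Icc 0 T))
    (hc : ContinuousOn (fun p : ℝ × ℝ => c p.1 p.2) (univ ×ˢ Icc 0 T))
    (hf : ContinuousOn (fun p : ℝ × ℝ => f p.1 p.2) (univ ×ˢ Icc 0 T))
    (hsx' : ContinuousOn (fun p : ℝ × ℝ => sx p.1 p.2) (univ ×ˢ Icc 0 T))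
    (hcx' : ContinuousOn (fun p : ℝ × ℝ => cx p.1 p.2) (univ ×ˢ Icc 0 T))
    (hfx' : ContinuousOn (fun p : ℝ × ℝ => fx p.1 p.2) (univ ×ˢ Icc 0 T)) :
    ∀ t ∈ Ioo 0 T, HasDerivAt (fun r => sx (X r) r)
      (fx (X t) t - cx (X t) t * sx (X t) t) t := by
  have along : ∀ {F : ℝ → ℝ → ℝ} (h : ℝ),
      ContinuousOn (fun p : ℝ × ℝ => F p.1 p.2) (univ ×ˢ Icc 0 T) →
      ContinuousOn (fun r => F (X r + h) r) (Icc 0 T) := fun {F} h hF =>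
    hF.comp (f := fun r : ℝ => (X r + h, r)) (by fun_prop) (fun r hr => ⟨trivial, hr⟩)
  have along0 : ∀ {F : ℝ → ℝ → ℝ},
      ContinuousOn (fun p : ℝ × ℝ => F p.1 p.2) (univ ×ˢ Icc 0 T) →
      ContinuousOn (fun r => F (X r) r) (Icc 0 T) := fun {F} hF => by
    simpa using along 0 hF
  set g : ℝ → ℝ := fun r => fx (X r) r - cx (X r) r * sx (X r) r with hg
  have hgcont : ContinuousOn g (Icc 0 T) := (along0 hfx').sub ((along0 hcx').mul (along0 hsx'))
  set G : ℝ → ℝ → ℝ := fun h r => h⁻¹ * (f (X r + h) r - f (X r) r) -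
    h⁻¹ * (c (X r + h) r - c (X r) r) * sx (X r + h) r with hG
  have hGcont : ∀ h, ContinuousOn (G h) (Icc 0 T) := fun h =>
    (((along h hf).sub (along0 hf)).const_mul _).sub
      ((((along h hc).sub (along0 hc)).const_mul _).mul (along h hsx'))
  have hquot : ∀ h, h ≠ 0 → ∀ b ∈ Icc 0 T,
      ∫ r in (0 : ℝ)..b, G h r =
        h⁻¹ * (s (X b + h) b - s (X b) b) - h⁻¹ * (s (X 0 + h) 0 - s (X 0) 0) := by
    intro h hh b hb
    have hsub : Icc 0 b ⊆ Icc 0 T := Icc_subset_Icc_right hb.2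
    refine intervalIntegral.integral_eq_sub_of_hasDerivAt_of_le (E := ℝ) (a := 0) (b := b)
      (f := fun r => h⁻¹ * (s (X r + h) r - s (X r) r)) hb.1
      ((((along h hs).sub (along0 hs)).const_mul _).mono hsub) (fun r hr => ?_)
      (((hGcont h).mono hsub).intervalIntegrable_of_Icc hb.1)
    have hr' : r ∈ Ioo 0 T := ⟨hr.1, hr.2.trans_le hb.2⟩
    have h0 := htrans 0 r hr'
    simp only [add_zero, sub_self, zero_mul] at h0
    refine (((htrans h r hr').sub h0).const_mul h⁻¹).congr_deriv ?_
    simp only [hG]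
    ring
  have hslope : ∀ {F Fx : ℝ → ℝ → ℝ}, (∀ t ∈ Icc 0 T, ∀ x, HasDerivAt (fun y => F y t) (Fx x t) x) →
      ∀ r ∈ Icc 0 T, Tendsto (fun h => h⁻¹ * (F (X r + h) r - F (X r) r)) (𝓝[≠] 0)
        (𝓝 (Fx (X r) r)) := fun {F Fx} hF r hr => by
    simpa using (hF r hr (X r)).tendsto_slope_zero
  have hbd : ∀ {F Fx : ℝ → ℝ → ℝ}, (∀ t ∈ Icc 0 T, ∀ x, HasDerivAt (fun y => F y t) (Fx x t) x) →
      (∀ t ∈ Icc 0 T, ∀ x, |Fx x t| ≤ M) →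
      ∀ r ∈ Icc 0 T, ∀ h ≠ 0, |h⁻¹ * (F (X r + h) r - F (X r) r)| ≤ M :=
    fun {F Fx} hF hFM r hr h hh => by
      have := abs_sub_le_of_hasDerivAt (hF r hr) (hFM r hr) (X r + h) (X r)
      rw [add_sub_cancel_left] at this
      rw [abs_mul, abs_inv, inv_mul_le_iff₀ (abs_pos.2 hh)]
      linarith
  have hlim : ∀ r ∈ Icc 0 T, Tendsto (fun h => G h r) (𝓝[≠] 0) (𝓝 (g r)) := by
    intro r hr
    refine (hslope hfx r hr).sub ((hslope hcx r hr).mul ?_)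
    have h1 : Continuous (fun h : ℝ => sx (X r + h) r) := by
      rw [← continuousOn_univ]
      exact hsx'.comp (f := fun h : ℝ => (X r + h, r)) (by fun_prop) (fun h _ => ⟨trivial, hr⟩)
    simpa using (h1.tendsto 0).mono_left (nhdsWithin_le_nhds (s := {0}ᶜ))
  have hFTC : ∀ b ∈ Icc 0 T, sx (X b) b - sx (X 0) 0 = ∫ r in (0 : ℝ)..b, g r := by
    intro b hb
    have hsub : Icc 0 b ⊆ Icc 0 T := Icc_subset_Icc_right hb.2
    have hIoc : uIoc 0 b ⊆ Icc 0 T := by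
      rw [uIoc_of_le hb.1]; exact Ioc_subset_Icc_self.trans hsub
    have h1 : Tendsto (fun h => ∫ r in (0 : ℝ)..b, G h r) (𝓝[≠] 0)
        (𝓝 (∫ r in (0 : ℝ)..b, g r)) := by
      refine intervalIntegral.tendsto_integral_filter_of_dominated_convergence
        (fun _ => M + M * M) (Eventually.of_forall fun h =>
          ((hGcont h).mono hIoc).aestronglyMeasurable measurableSet_uIoc) ?_ (by simp)
        (Eventually.of_forall fun r hr => hlim r (hIoc hr))
      filter_upwards [self_mem_nhdsWithin] with h hh
      refine Eventually.of_forall fun r hr => ?_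
      have hr' := hIoc hr
      have e1 := hbd hfx hfM r hr' h hh
      have e2 := hbd hcx hcM r hr' h hh
      have e3 := hsM r hr' (X r + h)
      have e4 := (abs_nonneg _).trans e1
      refine (abs_sub _ _).trans (add_le_add e1 ?_)
      rw [abs_mul]
      gcongr
    have h2 : Tendsto (fun h => ∫ r in (0 : ℝ)..b, G h r) (𝓝[≠] 0)
        (𝓝 (sx (X b) b - sx (X 0) 0)) := by
      refine ((hslope hsx b hb).sub (hslope hsx 0 ⟨le_rfl, hb.1.trans hb.2⟩)).congr' ?_
      filter_upwards [self_mem_nhdsWithin] with h hh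
      exact (hquot h hh b hb).symm
    exact tendsto_nhds_unique h2 h1
  intro t ht
  have ht' : t ∈ Icc 0 T := Ioo_subset_Icc_self ht
  have hnhds := Icc_mem_nhds ht.1 ht.2
  have hint := intervalIntegral.integral_hasDerivAt_right
    ((hgcont.mono (Icc_subset_Icc_right ht.2.le)).intervalIntegrable_of_Icc ht.1.le)
    (hgcont.mono Ioo_subset_Icc_self |>.stronglyMeasurableAtFilter isOpen_Ioo t ht)
    (hgcont.continuousAt hnhds)
  refine (hint.add_const (sx (X 0) 0)).congr_of_eventuallyEq ?_
  filter_upwards [hnhds] with b hb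
  linarith [hFTC b hb]

/-- The integrating factor `exp (μ ∫ a)` together with its antiderivative. -/
lemma exists_integrating_factor {a : ℝ → ℝ} {μ : ℝ} (hμ : 0 ≤ μ) (ha : ContinuousOn a (Ici 0))
    (ha0 : ∀ t, 0 ≤ t → 0 ≤ a t) :
    ∃ E H : ℝ → ℝ, Continuous E ∧ E 0 = 1 ∧ H 0 = 0 ∧ (∀ t, 0 ≤ t → 1 ≤ E t) ∧
      (∀ t, 0 < t → HasDerivAt E (μ * a t * E t) t) ∧ (∀ t, HasDerivAt H (E t) t) ∧
      ∀ t, 0 ≤ t → t ≤ H t := by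
  set b : ℝ → ℝ := fun t => a (max t 0) with hb
  have hbc : Continuous b := by
    rw [← continuousOn_univ]
    exact ha.comp (by fun_prop) (fun t _ => le_max_right t 0)
  have hb0 : ∀ t, 0 ≤ b t := fun t => ha0 _ (le_max_right t 0)
  have hA : ∀ t, HasDerivAt (fun t => ∫ r in (0 : ℝ)..t, b r) (b t) t := fun t =>
    (hbc.integral_hasStrictDerivAt 0 t).hasDerivAt
  set E : ℝ → ℝ := fun t => exp (μ * ∫ r in (0 : ℝ)..t, b r) with hE
  have hEd : ∀ t, HasDerivAt E (E t * (μ * b t)) t := fun t => ((hA t).const_mul μ).exp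
  have hEc : Continuous E := continuous_iff_continuousAt.2 fun t => (hEd t).continuousAt
  have hE1 : ∀ t, 0 ≤ t → 1 ≤ E t := fun t ht =>
    one_le_exp (mul_nonneg hμ (intervalIntegral.integral_nonneg ht fun r _ => hb0 r))
  refine ⟨E, fun t => ∫ r in (0 : ℝ)..t, E r, hEc, by simp [hE], by simp, hE1, ?_,
    fun t => (hEc.integral_hasStrictDerivAt 0 t).hasDerivAt, fun t ht => ?_⟩
  · intro t ht
    refine (hEd t).congr_deriv ?_
    simp only [hb, max_eq_left ht.le]
    ring
  · have := intervalIntegral.integral_mono_on (μ := volume) ht (f := fun _ => (1 : ℝ)) (g := E)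
      (by simp) (hEc.intervalIntegrable _ _) (fun r hr => hE1 r hr.1)
    simpa using this

section PartialDerivatives

variable {f : ℝ → ℝ → ℝ}

lemma pdx_eq_fderiv (hf : ContDiff ℝ 1 (fun p : ℝ × ℝ => f p.1 p.2)) (x t : ℝ) :
    HasDerivAt (fun y => f y t) (fderiv ℝ (fun p : ℝ × ℝ => f p.1 p.2) (x, t) (1, 0)) x :=
  ((hf.differentiable one_ne_zero (x, t)).hasFDerivAt).comp_hasDerivAt x
    (f := fun y : ℝ => (y, t)) ((hasDerivAt_id x).prodMk (hasDerivAt_const x t))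

lemma pdt_eq_fderiv (hf : ContDiff ℝ 1 (fun p : ℝ × ℝ => f p.1 p.2)) (x t : ℝ) :
    HasDerivAt (fun s => f x s) (fderiv ℝ (fun p : ℝ × ℝ => f p.1 p.2) (x, t) (0, 1)) t :=
  ((hf.differentiable one_ne_zero (x, t)).hasFDerivAt).comp_hasDerivAt t
    (f := fun s : ℝ => (x, s)) ((hasDerivAt_const t x).prodMk (hasDerivAt_id t))

lemma hasDerivAt_pdx (hf : ContDiff ℝ 1 (fun p : ℝ × ℝ => f p.1 p.2)) (x t : ℝ) :
    HasDerivAt (fun y => f y t) (pdx f x t) x :=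
  (pdx_eq_fderiv hf x t).differentiableAt.hasDerivAt

lemma hasDerivAt_pdt (hf : ContDiff ℝ 1 (fun p : ℝ × ℝ => f p.1 p.2)) (x t : ℝ) :
    HasDerivAt (fun s => f x s) (pdt f x t) t :=
  (pdt_eq_fderiv hf x t).differentiableAt.hasDerivAt

lemma continuous_pdx (hf : ContDiff ℝ 1 (fun p : ℝ × ℝ => f p.1 p.2)) :
    Continuous (fun p : ℝ × ℝ => pdx f p.1 p.2) := by
  have : (fun p : ℝ × ℝ => pdx f p.1 p.2) =
      fun p => fderiv ℝ (fun p : ℝ × ℝ => f p.1 p.2) p (1, 0) :=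
    funext fun p => (pdx_eq_fderiv hf p.1 p.2).deriv
  rw [this]
  exact (hf.continuous_fderiv one_ne_zero).clm_apply continuous_const

lemma hasDerivAt_along (hf : ContDiff ℝ 1 (fun p : ℝ × ℝ => f p.1 p.2)) {X : ℝ → ℝ} {X' t : ℝ}
    (hX : HasDerivAt X X' t) :
    HasDerivAt (fun r => f (X r) r) (pdx f (X t) t * X' + pdt f (X t) t) t := by
  refine (((hf.differentiable one_ne_zero (X t, t)).hasFDerivAt).comp_hasDerivAt t
    (f := fun r : ℝ => (X r, r)) (hX.prodMk (hasDerivAt_id t))).congr_deriv ?_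
  have h : ((X', 1) : ℝ × ℝ) = X' • (1, 0) + (0, 1) := by simp
  rw [h, map_add, map_smul, pdx, (pdx_eq_fderiv hf (X t) t).deriv, pdt,
    (pdt_eq_fderiv hf (X t) t).deriv, smul_eq_mul, mul_comm]

end PartialDerivatives

/-- The Lagrangian sound speed `√(-p'(τ))`. -/
noncomputable def speed (K γ : ℝ) (τ : ℝ → ℝ → ℝ) (x t : ℝ) : ℝ :=
  √(K * γ) * τ x t ^ (-(γ + 1) / 2)

/-- The damping coefficient. -/
noncomputable def damping (α lam t : ℝ) : ℝ := α / (1 + t) ^ lam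

/-- The space derivative of the forward Riemann invariant `u + φ`. -/
noncomputable def fwdGrad (K γ : ℝ) (τ u : ℝ → ℝ → ℝ) (x t : ℝ) : ℝ :=
  pdx u x t - speed K γ τ x t * pdx τ x t

section Damping

variable {α lam : ℝ}

lemma damping_nonneg (hα : 0 ≤ α) {t : ℝ} (ht : 0 ≤ t) : 0 ≤ damping α lam t :=
  div_nonneg hα (rpow_nonneg (by linarith) _)

lemma damping_zero : damping α lam 0 = α := by simp [damping]

lemma hasDerivAt_damping {t : ℝ} (ht : 0 ≤ t) :
    HasDerivAt (damping α lam) (-lam * damping α lam t / (1 + t)) t := by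
  have h1 : 0 < 1 + t := by linarith
  have h2 : HasDerivAt (fun s : ℝ => 1 + s) 1 t := (hasDerivAt_id t).const_add 1
  have h3 := ((h2.rpow_const (p := lam) (Or.inl h1.ne')).inv (rpow_pos_of_pos h1 _).ne').const_mul α
  refine (h3.congr_deriv ?_).congr_of_eventuallyEq (Eventually.of_forall fun s => ?_)
  · rw [damping, rpow_sub_one h1.ne']
    have := (rpow_pos_of_pos h1 lam).ne'
    field_simp
  · simp [damping, div_eq_mul_inv]

lemma continuousOn_damping : ContinuousOn (damping α lam) (Ici 0) := fun _ ht =>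
  (hasDerivAt_damping ht).continuousAt.continuousWithinAt

/-- The condition on `λ` says that the damping does not grow faster than the Riccati equation
allows. -/
lemma deriv_damping_le {γ : ℝ} (hγ1 : 1 < γ) (hγ3 : γ < 3) (hα : 0 ≤ α)
    (hlam : α * (γ - 1) / (γ - 3) ≤ lam) {t : ℝ} (ht : 0 ≤ t) :
    -lam * damping α lam t / (1 + t) ≤ (γ - 1) / (3 - γ) * damping α lam t ^ 2 := by
  have h1 : 0 < 1 + t := by linarith
  have h3 : 0 < 3 - γ := by linarith
  have ha := damping_nonneg (lam := lam) hα ht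
  have hκ : 0 ≤ (γ - 1) / (3 - γ) := div_nonneg (by linarith) h3.le
  have hlam' : -lam ≤ (γ - 1) / (3 - γ) * α := by
    have : α * (γ - 1) / (γ - 3) = -((γ - 1) / (3 - γ) * α) := by
      rw [show γ - 3 = -(3 - γ) by ring, div_neg]
      ring
    linarith
  have key : -lam ≤ (γ - 1) / (3 - γ) * (damping α lam t * (1 + t)) := by
    rcases le_total lam 0 with h | h
    · refine hlam'.trans (mul_le_mul_of_nonneg_left ?_ hκ)
      have hp : (1 + t) ^ lam ≤ 1 := rpow_le_one_of_one_le_of_nonpos (by linarith) h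
      have hp0 : 0 < (1 + t) ^ lam := rpow_pos_of_pos h1 _
      have : α ≤ damping α lam t := by
        rw [damping, le_div_iff₀ hp0]
        nlinarith
      nlinarith
    · have : 0 ≤ (γ - 1) / (3 - γ) * (damping α lam t * (1 + t)) := by positivity
      linarith
  rw [div_le_iff₀ h1]
  nlinarith

end Damping

lemma hasDerivAt_phi_comp {K γ : ℝ} (hγ1 : 1 < γ) {g : ℝ → ℝ} {g' r : ℝ} (hg : HasDerivAt g g' r)
    (hpos : 0 < g r) :
    HasDerivAt (fun r => 2 * √(K * γ) / (γ - 1) * g r ^ (-(γ - 1) / 2))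
      (-(√(K * γ) * g r ^ (-(γ + 1) / 2)) * g') r := by
  refine ((hg.rpow_const (p := -(γ - 1) / 2) (Or.inl hpos.ne')).const_mul _).congr_deriv ?_
  rw [show -(γ - 1) / 2 - 1 = -(γ + 1) / 2 by ring]
  have : γ - 1 ≠ 0 := by linarith
  field_simp

namespace IsSol

variable {K γ α lam : ℝ} {τ u : ℝ → ℝ → ℝ}

lemma pos (h : IsSol K γ α lam τ u) (x : ℝ) {t : ℝ} (ht : 0 ≤ t) : 0 < τ x t := h.2.2.1 x t ht

lemma pdt_tau (h : IsSol K γ α lam τ u) (x : ℝ) {t : ℝ} (ht : 0 ≤ t) : pdt τ x t = pdx u x t :=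
  h.2.2.2.1 x t ht

lemma pdt_u (h : IsSol K γ α lam τ u) (hK : 0 < K) (hγ1 : 1 < γ) (x : ℝ) {t : ℝ} (ht : 0 ≤ t) :
    pdt u x t = speed K γ τ x t ^ 2 * pdx τ x t - damping α lam t * u x t := by
  have hp := h.pos x ht
  have h1 : pdx (fun y s => K * τ y s ^ (-γ)) x t = -speed K γ τ x t ^ 2 * pdx τ x t := by
    rw [pdx, (((hasDerivAt_pdx h.1 x t).rpow_const (p := -γ) (Or.inl hp.ne')).const_mul K).deriv,
      speed, mul_pow, sq_sqrt (by positivity), ← rpow_mul_natCast hp.le]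
    rw [show -(γ + 1) / 2 * ((2 : ℕ) : ℝ) = -γ - 1 by push_cast; ring]
    ring
  have h2 := h.2.2.2.2 x t ht
  rw [h1] at h2
  rw [damping]
  linarith

lemma phi_pdx (h : IsSol K γ α lam τ u) (hγ1 : 1 < γ) (x : ℝ) {t : ℝ} (ht : 0 ≤ t) :
    HasDerivAt (fun y => Phi K γ τ y t) (-speed K γ τ x t * pdx τ x t) x :=
  hasDerivAt_phi_comp hγ1 (hasDerivAt_pdx h.1 x t) (h.pos x ht)

lemma phi_pdt (h : IsSol K γ α lam τ u) (hγ1 : 1 < γ) (x : ℝ) {t : ℝ} (ht : 0 ≤ t) :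
    HasDerivAt (fun s => Phi K γ τ x s) (-speed K γ τ x t * pdx u x t) t := by
  rw [← h.pdt_tau x ht]
  exact hasDerivAt_phi_comp hγ1 (hasDerivAt_pdt h.1 x t) (h.pos x ht)

lemma continuousOn_rpow (h : IsSol K γ α lam τ u) (p T : ℝ) :
    ContinuousOn (fun q : ℝ × ℝ => τ q.1 q.2 ^ p) (univ ×ˢ Icc 0 T) :=
  h.1.continuous.continuousOn.rpow_const fun q hq => Or.inl (h.pos q.1 hq.2.1).ne'

lemma continuousOn_speed (h : IsSol K γ α lam τ u) (T : ℝ) :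
    ContinuousOn (fun q : ℝ × ℝ => speed K γ τ q.1 q.2) (univ ×ˢ Icc 0 T) :=
  (h.continuousOn_rpow _ T).const_mul _

lemma continuousOn_phi (h : IsSol K γ α lam τ u) (T : ℝ) :
    ContinuousOn (fun q : ℝ × ℝ => Phi K γ τ q.1 q.2) (univ ×ˢ Icc 0 T) :=
  (h.continuousOn_rpow _ T).const_mul _

lemma continuousOn_fwdGrad (h : IsSol K γ α lam τ u) (T : ℝ) :
    ContinuousOn (fun q : ℝ × ℝ => fwdGrad K γ τ u q.1 q.2) (univ ×ˢ Icc 0 T) :=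
  (continuous_pdx h.2.1).continuousOn.sub
    ((h.continuousOn_speed T).mul (continuous_pdx h.1).continuousOn)

lemma speed_pos (h : IsSol K γ α lam τ u) (hK : 0 < K) (hγ1 : 1 < γ) (x : ℝ) {t : ℝ}
    (ht : 0 ≤ t) : 0 < speed K γ τ x t :=
  mul_pos (sqrt_pos.2 (by positivity)) (rpow_pos_of_pos (h.pos x ht) _)

/-- The maximum of the absolute values of the Riemann invariants does not increase, as long as the
sound speed stays bounded. -/
lemma abs_add_phi_le (h : IsSol K γ α lam τ u) (hK : 0 < K) (hγ1 : 1 < γ) (hα : 0 ≤ α)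
    {T M δ B : ℝ} (hδ : 0 < δ) (hM : ∀ x, ∀ t ∈ Icc 0 T, |pdx u x t| ≤ M)
    (hlow : ∀ x, ∀ t ∈ Icc 0 T, δ ≤ τ x t) (h0 : ∀ x, |u x 0| + Phi K γ τ x 0 ≤ B) :
    ∀ x, ∀ t ∈ Icc 0 T, |u x t| + Phi K γ τ x t ≤ B := by
  rcases (Icc 0 T).eq_empty_or_nonempty with hT | ⟨r, hr⟩
  · simp [hT]
  have hM0 : 0 ≤ M := (abs_nonneg _).trans (hM 0 r hr)
  have hu : Continuous (fun q : ℝ × ℝ => u q.1 q.2) := h.2.1.continuous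
  obtain ⟨A, hA⟩ := (isCompact_Icc (a := (0 : ℝ)) (b := T)).exists_bound_of_continuousOn
    (f := fun t => u 0 t) (hu.comp (by fun_prop : Continuous fun t : ℝ => ((0 : ℝ), t))).continuousOn
  have hγ' : 0 < γ - 1 := by linarith
  refine le_of_transport_touching (L := √(K * γ) * δ ^ (-(γ + 1) / 2)) (M := M)
    (A := A + 2 * √(K * γ) / (γ - 1) * δ ^ (-(γ - 1) / 2)) (by positivity) hM0
    (hu.abs.continuousOn.add (h.continuousOn_phi T)) (fun x t ht => ?_) h0 (fun x t ht => ?_)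
  · have h1 : |u x t - u 0 t| ≤ M * |x - 0| :=
      abs_sub_le_of_hasDerivAt (fun y => hasDerivAt_pdx h.2.1 y t) (fun y => hM y t ht) x 0
    have h2 : |u 0 t| ≤ A := hA t ht
    have h3 : Phi K γ τ x t ≤ 2 * √(K * γ) / (γ - 1) * δ ^ (-(γ - 1) / 2) :=
      mul_le_mul_of_nonneg_left (rpow_le_rpow_of_nonpos hδ (hlow x t ht) (by linarith))
        (by positivity)
    have h4 := abs_add_le (u x t - u 0 t) (u 0 t)
    rw [sub_add_cancel] at h4
    rw [sub_zero] at h1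
    linarith
  · have ht' : t ∈ Icc 0 T := Ioc_subset_Icc_self ht
    have hc := h.speed_pos hK hγ1 x ht'.1
    have hcL : speed K γ τ x t ≤ √(K * γ) * δ ^ (-(γ + 1) / 2) :=
      mul_le_mul_of_nonneg_left (rpow_le_rpow_of_nonpos hδ (hlow x t ht') (by linarith))
        (by positivity)
    have ha := damping_nonneg (lam := lam) hα ht'.1
    have hbound : ∀ w : ℝ, speed K γ τ x t * w ≤ √(K * γ) * δ ^ (-(γ + 1) / 2) * |w| := fun w =>
      (mul_le_mul_of_nonneg_left (le_abs_self w) hc.le).trans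
        (mul_le_mul_of_nonneg_right hcL (abs_nonneg w))
    rcases le_total 0 (u x t) with hux | hux
    · refine ⟨fun y s => u y s + Phi K γ τ y s, pdx u x t + -speed K γ τ x t * pdx τ x t,
        pdt u x t + -speed K γ τ x t * pdx u x t, fun y s _ => add_le_add (le_abs_self _) le_rfl,
        by simp only [abs_of_nonneg hux],
        (hasDerivAt_pdx h.2.1 x t).add (h.phi_pdx hγ1 x ht'.1),
        (hasDerivAt_pdt h.2.1 x t).add (h.phi_pdt hγ1 x ht'.1), ?_⟩
      rw [h.pdt_u hK hγ1 x ht'.1]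
      have := hbound (-(pdx u x t + -speed K γ τ x t * pdx τ x t))
      rw [abs_neg] at this
      nlinarith [mul_nonneg ha hux]
    · refine ⟨fun y s => -u y s + Phi K γ τ y s, -pdx u x t + -speed K γ τ x t * pdx τ x t,
        -pdt u x t + -speed K γ τ x t * pdx u x t, fun y s _ => add_le_add (neg_le_abs _) le_rfl,
        by simp only [abs_of_nonpos hux],
        (hasDerivAt_pdx h.2.1 x t).neg.add (h.phi_pdx hγ1 x ht'.1),
        (hasDerivAt_pdt h.2.1 x t).neg.add (h.phi_pdt hγ1 x ht'.1), ?_⟩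
      rw [h.pdt_u hK hγ1 x ht'.1]
      have := hbound (-pdx u x t + -speed K γ τ x t * pdx τ x t)
      nlinarith [mul_nonpos_of_nonneg_of_nonpos ha hux]

/-- While the gradient stays bounded, no concentration `τ → 0` can occur. -/
lemma exists_tau_lower_bound (h : IsSol K γ α lam τ u) (hK : 0 < K) (hγ1 : 1 < γ) (hα : 0 ≤ α)
    {C₀ T M : ℝ} (hC₀ : 0 < C₀) (hu₀ : ∀ x, |u x 0| ≤ C₀) (hτ₀ : ∀ x, C₀⁻¹ < τ x 0)
    (hM : ∀ x, ∀ t ∈ Icc 0 T, |pdx u x t| ≤ M) :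
    ∃ δ > 0, ∀ x, ∀ t ∈ Icc 0 T, δ ≤ τ x t := by
  rcases (Icc 0 T).eq_empty_or_nonempty with hT | ⟨r, hr⟩
  · exact ⟨1, one_pos, by simp [hT]⟩
  have hM0 : 0 ≤ M := (abs_nonneg _).trans (hM 0 r hr)
  have hγ' : 0 < γ - 1 := by linarith
  have hk : 0 < 2 * √(K * γ) / (γ - 1) := by
    have := sqrt_pos.2 (show 0 < K * γ by positivity)
    positivity
  set B := C₀ + 2 * √(K * γ) / (γ - 1) * C₀⁻¹ ^ (-(γ - 1) / 2) with hB
  have hBpos : 0 < B := by positivity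
  have h0 : ∀ x, |u x 0| + Phi K γ τ x 0 ≤ B := fun x =>
    add_le_add (hu₀ x) (mul_le_mul_of_nonneg_left
      (rpow_le_rpow_of_nonpos (inv_pos.2 hC₀) (hτ₀ x).le (by linarith)) hk.le)
  set δ := (B / (2 * √(K * γ) / (γ - 1))) ^ (2 / (-(γ - 1))) with hδ
  have hδpos : 0 < δ := rpow_pos_of_pos (by positivity) _
  have hphi : ∀ x, ∀ t, 0 ≤ t → |u x t| + Phi K γ τ x t ≤ B → δ ≤ τ x t := by
    intro x t ht hle
    have h1 : τ x t ^ (-(γ - 1) / 2) ≤ B / (2 * √(K * γ) / (γ - 1)) := by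
      rw [le_div_iff₀ hk, mul_comm]
      have : Phi K γ τ x t ≤ B := by linarith [abs_nonneg (u x t)]
      exact this
    have hp := h.pos x ht
    have h2 := rpow_le_rpow_of_nonpos (z := 2 / (-(γ - 1))) (rpow_pos_of_pos hp _) h1
      (div_nonpos_of_nonneg_of_nonpos (by norm_num) (by linarith))
    rw [← rpow_mul hp.le, show -(γ - 1) / 2 * (2 / (-(γ - 1))) = 1 by field_simp, rpow_one] at h2
    exact h2
  refine ⟨δ, hδpos, ?_⟩
  set d := δ / (2 * (M + 1)) with hd
  have hdpos : 0 < d := by positivity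
  have step : ∀ n : ℕ, ∀ x, ∀ t ∈ Icc 0 (min T (n * d)), δ ≤ τ x t := by
    intro n
    induction n with
    | zero =>
      intro x t ht
      have : t = 0 := le_antisymm (by simpa using ht.2.trans (min_le_right _ _)) ht.1
      subst this
      exact hphi x 0 le_rfl (h0 x)
    | succ n ih =>
      have hhalf : ∀ x, ∀ t ∈ Icc 0 (min T ((n + 1 : ℕ) * d)), δ / 2 ≤ τ x t := by
        intro x t ht
        have htT : t ≤ T := ht.2.trans (min_le_left _ _)
        have htn : t ≤ (n + 1) * d := by simpa using ht.2.trans (min_le_right _ _)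
        set s := min t (n * d) with hs
        have hs0 : 0 ≤ s := le_min ht.1 (by positivity)
        have hst : s ≤ t := min_le_left _ _
        have h1 := ih x s ⟨hs0, le_min (hst.trans htT) (min_le_right _ _)⟩
        have h2 : t - s ≤ d := by
          rcases min_choice t (n * d) with hc | hc <;> rw [hs, hc] <;> linarith
        have h3 : ‖τ x t - τ x s‖ ≤ M * ‖t - s‖ :=
          (convex_Icc 0 T).norm_image_sub_le_of_norm_hasDerivWithin_le
            (f' := fun r => pdx u x r)
            (fun r hr => by
              rw [← h.pdt_tau x hr.1]; exact (hasDerivAt_pdt h.1 x r).hasDerivWithinAt)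
            (fun r hr => hM x r hr) ⟨hs0, hst.trans htT⟩ ⟨ht.1, htT⟩
        rw [norm_eq_abs, norm_eq_abs, abs_of_nonneg (sub_nonneg.2 hst)] at h3
        have h4 : M * (t - s) ≤ δ / 2 := by
          calc M * (t - s) ≤ (M + 1) * d := by gcongr; linarith
            _ = δ / 2 := by rw [hd]; field_simp
        linarith [(abs_le.1 h3).1]
      intro x t ht
      exact hphi x t ht.1 (h.abs_add_phi_le hK hγ1 hα (half_pos hδpos)
        (fun y s hs => hM y s ⟨hs.1, hs.2.trans (min_le_left _ _)⟩) hhalf h0 x t ht)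
  intro x t ht
  obtain ⟨n, hn⟩ := exists_nat_ge (t / d)
  exact step n x t ⟨ht.1, le_min ht.2 ((div_le_iff₀ hdpos).1 hn)⟩

end IsSol

/-- The Riccati inequality for the weighted gradient `τ^{-(γ+1)/4} (p + 2 a τ / (3 - γ)) / E`. -/
lemma riccati_inequality {γ t R P a' : ℝ} (hγ3 : γ < 3) {θ p a E : ℝ → ℝ}
    (hθ : HasDerivAt θ R t) (hP : p t = P)
    (hp : HasDerivAt p (-(a t * ((P + R) / 2)) - (γ + 1) / 4 * (P - R) / θ t * P) t)
    (ha : HasDerivAt a a' t) (hE : HasDerivAt E ((3 * γ - 1) / (2 * (3 - γ)) * a t * E t) t)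
    (hθ0 : 0 < θ t) (hE0 : 0 < E t) (ha' : a' ≤ (γ - 1) / (3 - γ) * a t ^ 2) :
    ∃ v', HasDerivAt (fun r => θ r ^ (-((γ + 1) / 4)) * (p r + 2 / (3 - γ) * a r * θ r) / E r) v' t ∧
      v' ≤ -((γ + 1) / 4 * θ t ^ ((γ + 1) / 4 - 1) * E t *
        (θ t ^ (-((γ + 1) / 4)) * (p t + 2 / (3 - γ) * a t * θ t) / E t) ^ 2) := by
  have h3 : 0 < 3 - γ := by linarith
  refine ⟨_, (((hθ.rpow_const (p := -((γ + 1) / 4)) (Or.inl hθ0.ne')).mul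
    (hp.add ((ha.const_mul (2 / (3 - γ))).mul hθ))).div hE hE0.ne'), ?_⟩
  simp only [Pi.add_apply, Pi.mul_apply]
  rw [rpow_sub_one hθ0.ne', rpow_sub_one hθ0.ne', hP]
  have e1 : θ t ^ ((γ + 1) / 4) = (θ t ^ (-((γ + 1) / 4)))⁻¹ := by
    rw [rpow_neg hθ0.le, inv_inv]
  rw [e1]
  have hw : 0 < θ t ^ (-((γ + 1) / 4)) := rpow_pos_of_pos hθ0 _
  generalize θ t ^ (-((γ + 1) / 4)) = w at *
  rw [← sub_nonpos]
  have hfac : w / E t * (2 / (3 - γ) * θ t) * (a' - (γ - 1) / (3 - γ) * a t ^ 2) ≤ 0 :=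
    mul_nonpos_of_nonneg_of_nonpos (by positivity) (by linarith)
  refine le_of_eq_of_le ?_ hfac
  have := hE0.ne'
  have := hθ0.ne'
  field_simp
  ring

/-- The weighted gradient of the forward Riemann invariant, which satisfies a Riccati inequality
along forward characteristics. -/
noncomputable def riccatiVar (K γ α lam : ℝ) (τ u : ℝ → ℝ → ℝ) (E : ℝ → ℝ) (x t : ℝ) : ℝ :=
  τ x t ^ (-((γ + 1) / 4)) *
    (fwdGrad K γ τ u x t + 2 / (3 - γ) * damping α lam t * τ x t) / E t

namespace IsSol

variable {K γ α lam : ℝ} {τ u : ℝ → ℝ → ℝ}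

lemma speed_pdx (h : IsSol K γ α lam τ u) (x : ℝ) {t : ℝ} (ht : 0 ≤ t) :
    HasDerivAt (fun y => speed K γ τ y t)
      (-(γ + 1) / 2 * (speed K γ τ x t * pdx τ x t) / τ x t) x := by
  have hp := h.pos x ht
  refine (((hasDerivAt_pdx h.1 x t).rpow_const (p := -(γ + 1) / 2)
    (Or.inl hp.ne')).const_mul _).congr_deriv ?_
  rw [rpow_sub_one hp.ne', speed]
  ring

lemma invariant_pdx (h : IsSol K γ α lam τ u) (hγ1 : 1 < γ) (x : ℝ) {t : ℝ} (ht : 0 ≤ t) :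
    HasDerivAt (fun y => u y t + Phi K γ τ y t) (fwdGrad K γ τ u x t) x :=
  ((hasDerivAt_pdx h.2.1 x t).add (h.phi_pdx hγ1 x ht)).congr_deriv (by rw [fwdGrad]; ring)

lemma speed_le (h : IsSol K γ α lam τ u) (hγ1 : 1 < γ) {δ x t : ℝ} (ht : 0 ≤ t) (hδ : 0 < δ)
    (hlow : δ ≤ τ x t) :
    |speed K γ τ x t| ≤ √(K * γ) * δ ^ (-(γ + 1) / 2) := by
  have hp := rpow_nonneg (h.pos x ht).le (-(γ + 1) / 2)
  rw [speed, abs_of_nonneg (by positivity)]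
  exact mul_le_mul_of_nonneg_left (rpow_le_rpow_of_nonpos hδ hlow (by linarith)) (sqrt_nonneg _)

lemma exists_speed_bounds (h : IsSol K γ α lam τ u) (hγ1 : 1 < γ)
    {T M δ : ℝ} (hδ : 0 < δ) (hlow : ∀ x, ∀ t ∈ Icc 0 T, δ ≤ τ x t)
    (hτM : ∀ x, ∀ t ∈ Icc 0 T, |pdx τ x t| ≤ M) :
    ∃ L, ∀ x, ∀ t ∈ Icc 0 T, |speed K γ τ x t| ≤ L ∧ |speed K γ τ x t * pdx τ x t| ≤ L ∧
      |-(γ + 1) / 2 * (speed K γ τ x t * pdx τ x t) / τ x t| ≤ L := by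
  set L := √(K * γ) * δ ^ (-(γ + 1) / 2)
  have hL : 0 ≤ L := by positivity
  refine ⟨max L (max (L * M) ((γ + 1) / 2 * (L * M) / δ)), fun x t ht => ?_⟩
  have h1 : |speed K γ τ x t| ≤ L := h.speed_le hγ1 ht.1 hδ (hlow x t ht)
  have h2 : |speed K γ τ x t * pdx τ x t| ≤ L * M := by
    rw [abs_mul]
    exact mul_le_mul h1 (hτM x t ht) (abs_nonneg _) hL
  refine ⟨h1.trans (le_max_left _ _), h2.trans ((le_max_left _ _).trans (le_max_right _ _)),
    le_trans ?_ ((le_max_right _ _).trans (le_max_right _ _))⟩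
  rw [abs_div, abs_mul, abs_of_pos (h.pos x ht.1), abs_div, abs_neg,
    abs_of_pos (show 0 < γ + 1 by linarith), abs_two]
  have := (abs_nonneg _).trans h2
  gcongr
  exact hlow x t ht

/-- Through every point of the strip there passes a forward characteristic. -/
lemma exists_characteristic (h : IsSol K γ α lam τ u) (hγ1 : 1 < γ)
    {T M δ : ℝ} (hδ : 0 < δ) (hlow : ∀ x, ∀ t ∈ Icc 0 T, δ ≤ τ x t)
    (hτM : ∀ x, ∀ t ∈ Icc 0 T, |pdx τ x t| ≤ M) {t₀ : ℝ} (ht₀ : t₀ ∈ Icc 0 T) (x₀ : ℝ) :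
    ∃ X : ℝ → ℝ, X t₀ = x₀ ∧ ContinuousOn X (Icc 0 T) ∧
      ∀ t ∈ Ioo 0 T, HasDerivAt X (speed K γ τ (X t) t) t := by
  obtain ⟨L, hL⟩ := h.exists_speed_bounds (K := K) hγ1 hδ hlow hτM
  exact exists_integralCurve ht₀ (h.continuousOn_speed T) (fun x t ht => (hL x t ht).1)
    (fun t ht => abs_sub_le_of_hasDerivAt (fun x => h.speed_pdx x ht.1)
      (fun x => (hL x t ht).2.2))

lemma fwdGrad_along (h : IsSol K γ α lam τ u) (hK : 0 < K) (hγ1 : 1 < γ)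
    {T M δ : ℝ} (hδ : 0 < δ) (hlow : ∀ x, ∀ t ∈ Icc 0 T, δ ≤ τ x t)
    (hτM : ∀ x, ∀ t ∈ Icc 0 T, |pdx τ x t| ≤ M) (huM : ∀ x, ∀ t ∈ Icc 0 T, |pdx u x t| ≤ M)
    {X : ℝ → ℝ} (hX : ContinuousOn X (Icc 0 T))
    (hX' : ∀ t ∈ Ioo 0 T, HasDerivAt X (speed K γ τ (X t) t) t) :
    ∀ t ∈ Ioo 0 T, HasDerivAt (fun r => fwdGrad K γ τ u (X r) r)
      (-damping α lam t * pdx u (X t) t -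
        -(γ + 1) / 2 * (speed K γ τ (X t) t * pdx τ (X t) t) / τ (X t) t *
          fwdGrad K γ τ u (X t) t) t := by
  obtain ⟨L, hL⟩ := h.exists_speed_bounds (K := K) hγ1 hδ hlow hτM
  have hdamp : ContinuousOn (fun q : ℝ × ℝ => -damping α lam q.2) (univ ×ˢ Icc 0 T) :=
    (continuousOn_damping.comp continuousOn_snd fun q hq => hq.2.1).neg
  obtain ⟨D, hD⟩ := (isCompact_Icc (a := (0 : ℝ)) (b := T)).exists_bound_of_continuousOn
    (f := damping α lam) (continuousOn_damping.mono fun t ht => ht.1)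
  have hux := (continuous_pdx h.2.1).continuousOn (s := univ ×ˢ Icc 0 T)
  refine hasDerivAt_spatialDeriv_along (s := fun x t => u x t + Phi K γ τ x t)
    (c := speed K γ τ) (f := fun x t => -damping α lam t * u x t)
    (cx := fun x t => -(γ + 1) / 2 * (speed K γ τ x t * pdx τ x t) / τ x t)
    (fx := fun x t => -damping α lam t * pdx u x t)
    (M := max (M + L) (max L (D * M))) hX (fun η t ht => ?_)
    (fun t ht x => h.invariant_pdx hγ1 x ht.1) (fun t ht x => h.speed_pdx x ht.1)
    (fun t ht x => (hasDerivAt_pdx h.2.1 x t).const_mul _) (fun t ht x => ?_)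
    (fun t ht x => (hL x t ht).2.2.trans ((le_max_left _ _).trans (le_max_right _ _)))
    (fun t ht x => ?_) (h.2.1.continuous.continuousOn.add (h.continuousOn_phi T))
    (h.continuousOn_speed T) (hdamp.mul h.2.1.continuous.continuousOn)
    (h.continuousOn_fwdGrad T)
    ((continuousOn_const.mul ((h.continuousOn_speed T).mul (continuous_pdx h.1).continuousOn)).div
      h.1.continuous.continuousOn fun q hq => (h.pos q.1 hq.2.1).ne')
    (hdamp.mul hux)
  · have hXη : HasDerivAt (fun r => X r + η) (speed K γ τ (X t) t) t := (hX' t ht).add_const η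
    refine ((hasDerivAt_along h.2.1 hXη).add (hasDerivAt_phi_comp hγ1 (hasDerivAt_along h.1 hXη)
      (h.pos _ ht.1.le))).congr_deriv ?_
    rw [h.pdt_u hK hγ1 _ ht.1.le, h.pdt_tau _ ht.1.le, fwdGrad]
    change _ + -speed K γ τ (X t + η) t * _ = _
    ring
  · refine le_trans ?_ (le_max_left _ _)
    exact (abs_sub _ _).trans (add_le_add (huM x t ht) (hL x t ht).2.1)
  · refine le_trans ?_ ((le_max_right _ _).trans (le_max_right _ _))
    rw [abs_mul, abs_neg]
    have h1 : |damping α lam t| ≤ D := hD t ht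
    exact mul_le_mul h1 (huM x t ht) (abs_nonneg _) ((abs_nonneg _).trans h1)

lemma riccatiVar_along (h : IsSol K γ α lam τ u) (hK : 0 < K) (hγ1 : 1 < γ) (hγ3 : γ < 3)
    (hα : 0 ≤ α) (hlam : α * (γ - 1) / (γ - 3) ≤ lam)
    {T M δ : ℝ} (hδ : 0 < δ) (hlow : ∀ x, ∀ t ∈ Icc 0 T, δ ≤ τ x t)
    (hτM : ∀ x, ∀ t ∈ Icc 0 T, |pdx τ x t| ≤ M) (huM : ∀ x, ∀ t ∈ Icc 0 T, |pdx u x t| ≤ M)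
    {E : ℝ → ℝ} (hE1 : ∀ t, 0 ≤ t → 1 ≤ E t)
    (hE' : ∀ t, 0 < t → HasDerivAt E ((3 * γ - 1) / (2 * (3 - γ)) * damping α lam t * E t) t)
    {X : ℝ → ℝ} (hX : ContinuousOn X (Icc 0 T))
    (hX' : ∀ t ∈ Ioo 0 T, HasDerivAt X (speed K γ τ (X t) t) t) :
    ∀ t ∈ Ioo 0 T, ∃ v', HasDerivAt (fun r => riccatiVar K γ α lam τ u E (X r) r) v' t ∧
      v' ≤ -((γ + 1) / 4 * τ (X t) t ^ ((γ + 1) / 4 - 1) * E t *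
        riccatiVar K γ α lam τ u E (X t) t ^ 2) := by
  intro t ht
  have hpos := h.pos (X t) ht.1.le
  have hθ := hasDerivAt_along h.1 (hX' t ht)
  refine riccati_inequality (θ := fun r => τ (X r) r) (p := fun r => fwdGrad K γ τ u (X r) r)
    (P := fwdGrad K γ τ u (X t) t) hγ3 hθ rfl ?_ (hasDerivAt_damping ht.1.le) (hE' t ht.1) hpos
    (zero_lt_one.trans_le (hE1 t ht.1.le)) (deriv_damping_le hγ1 hγ3 hα hlam ht.1.le)
  refine (h.fwdGrad_along hK hγ1 hδ hlow hτM huM hX hX' t ht).congr_deriv ?_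
  rw [h.pdt_tau _ ht.1.le, fwdGrad]
  field_simp
  ring

lemma continuousOn_riccatiVar (h : IsSol K γ α lam τ u) {T : ℝ} {E : ℝ → ℝ} (hE : Continuous E)
    (hE1 : ∀ t, 0 ≤ t → 1 ≤ E t) {X : ℝ → ℝ} (hX : ContinuousOn X (Icc 0 T)) :
    ContinuousOn (fun r => riccatiVar K γ α lam τ u E (X r) r) (Icc 0 T) := by
  have hXr : ContinuousOn (fun r : ℝ => (X r, r)) (Icc 0 T) := by fun_prop
  have hmaps : MapsTo (fun r : ℝ => (X r, r)) (Icc 0 T) (univ ×ˢ Icc 0 T) :=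
    fun r hr => ⟨trivial, hr⟩
  refine (((h.continuousOn_rpow _ T).comp hXr hmaps).mul
    (((h.continuousOn_fwdGrad T).comp hXr hmaps).add ((continuousOn_const.mul
      (continuousOn_damping.mono fun r hr => hr.1)).mul
        (h.1.continuous.comp_continuousOn hXr)))).div hE.continuousOn
    fun r hr => (zero_lt_one.trans_le (hE1 r hr.1)).ne'

lemma antitoneOn_riccatiVar (h : IsSol K γ α lam τ u) (hK : 0 < K) (hγ1 : 1 < γ) (hγ3 : γ < 3)
    (hα : 0 ≤ α) (hlam : α * (γ - 1) / (γ - 3) ≤ lam)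
    {T M δ : ℝ} (hδ : 0 < δ) (hlow : ∀ x, ∀ t ∈ Icc 0 T, δ ≤ τ x t)
    (hτM : ∀ x, ∀ t ∈ Icc 0 T, |pdx τ x t| ≤ M) (huM : ∀ x, ∀ t ∈ Icc 0 T, |pdx u x t| ≤ M)
    {E : ℝ → ℝ} (hE : Continuous E) (hE1 : ∀ t, 0 ≤ t → 1 ≤ E t)
    (hE' : ∀ t, 0 < t → HasDerivAt E ((3 * γ - 1) / (2 * (3 - γ)) * damping α lam t * E t) t)
    {X : ℝ → ℝ} (hX : ContinuousOn X (Icc 0 T))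
    (hX' : ∀ t ∈ Ioo 0 T, HasDerivAt X (speed K γ τ (X t) t) t) :
    AntitoneOn (fun r => riccatiVar K γ α lam τ u E (X r) r) (Icc 0 T) := by
  have hd := h.riccatiVar_along hK hγ1 hγ3 hα hlam hδ hlow hτM huM hE1 hE' hX hX'
  refine antitoneOn_of_deriv_nonpos (convex_Icc 0 T) (h.continuousOn_riccatiVar hE hE1 hX)
    (fun t ht => ?_) (fun t ht => ?_)
  · rw [interior_Icc] at ht
    obtain ⟨v', hv, -⟩ := hd t ht
    exact hv.differentiableAt.differentiableWithinAt
  · rw [interior_Icc] at ht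
    obtain ⟨v', hv, hle⟩ := hd t ht
    rw [hv.deriv]
    refine hle.trans (neg_nonpos.2 ?_)
    have h1 := rpow_pos_of_pos (h.pos (X t) ht.1.le) ((γ + 1) / 4 - 1)
    have h2 := zero_lt_one.trans_le (hE1 t ht.1.le)
    have h3 : 0 < γ + 1 := by linarith
    positivity

/-- The equations are invariant under the reflection `x ↦ -x`, `u ↦ -u`. -/
lemma reflect (h : IsSol K γ α lam τ u) :
    IsSol K γ α lam (fun x t => τ (-x) t) (fun x t => -u (-x) t) := by
  have hmap : ContDiff ℝ 1 (fun p : ℝ × ℝ => (-p.1, p.2)) := by fun_prop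
  refine ⟨h.1.comp hmap, (h.2.1.comp hmap).neg, fun x t ht => h.pos (-x) ht, fun x t ht => ?_,
    fun x t ht => ?_⟩
  · have h1 := h.pdt_tau (-x) ht
    simp only [pdt, pdx] at h1 ⊢
    rw [h1, deriv.fun_neg, deriv_comp_neg (fun y => u y t), neg_neg]
  · have h1 := h.2.2.2.2 (-x) t ht
    simp only [pdt, pdx] at h1 ⊢
    rw [deriv.fun_neg, deriv_comp_neg (fun y => K * τ y t ^ (-γ))]
    linarith

end IsSol

/-- Bounds on the initial data: `C¹` bounds and absence of concentration. -/
structure BoundedData (C₀ : ℝ) (τ u : ℝ → ℝ → ℝ) : Prop where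
  u_le : ∀ x, |u x 0| ≤ C₀
  ux_le : ∀ x, |pdx u x 0| ≤ C₀
  tau_le : ∀ x, τ x 0 ≤ C₀
  taux_le : ∀ x, |pdx τ x 0| ≤ C₀
  lt_tau : ∀ x, C₀⁻¹ < τ x 0

/-- The gradient is bounded on every finite time strip. -/
def GradBounded (τ u : ℝ → ℝ → ℝ) : Prop :=
  ∀ T > 0, ∃ M, ∀ x, ∀ t ∈ Icc 0 T, |pdx τ x t| ≤ M ∧ |pdx u x t| ≤ M

lemma gradBounded_of_not_blowsUp {τ u : ℝ → ℝ → ℝ} (h : ¬ BlowsUp τ u) : GradBounded τ u := by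
  intro T hT
  have hb : BddAbove {r : ℝ | ∃ x t, 0 ≤ t ∧ t ≤ T ∧ r = |pdx τ x t| + |pdx u x t|} :=
    not_not.1 fun hn => h ⟨T, hT, hn⟩
  obtain ⟨M, hM⟩ := hb
  refine ⟨M, fun x t ht => ?_⟩
  have := hM ⟨x, t, ht.1, ht.2, rfl⟩
  constructor <;> linarith [abs_nonneg (pdx τ x t), abs_nonneg (pdx u x t)]

lemma pdx_reflect (f : ℝ → ℝ → ℝ) (x t : ℝ) : pdx (fun y s => f (-y) s) x t = -pdx f (-x) t :=
  deriv_comp_neg (fun y => f y t) x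

lemma pdx_neg_reflect (f : ℝ → ℝ → ℝ) (x t : ℝ) : pdx (fun y s => -f (-y) s) x t = pdx f (-x) t := by
  simp only [pdx]
  rw [deriv.fun_neg, deriv_comp_neg (fun y => f y t), neg_neg]

lemma BoundedData.reflect {C₀ : ℝ} {τ u : ℝ → ℝ → ℝ} (h : BoundedData C₀ τ u) :
    BoundedData C₀ (fun x t => τ (-x) t) (fun x t => -u (-x) t) where
  u_le x := by rw [abs_neg]; exact h.u_le (-x)
  ux_le x := by rw [pdx_neg_reflect]; exact h.ux_le (-x)
  tau_le x := h.tau_le (-x)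
  taux_le x := by rw [pdx_reflect, abs_neg]; exact h.taux_le (-x)
  lt_tau x := h.lt_tau (-x)

lemma GradBounded.reflect {τ u : ℝ → ℝ → ℝ} (h : GradBounded τ u) :
    GradBounded (fun x t => τ (-x) t) (fun x t => -u (-x) t) := by
  intro T hT
  obtain ⟨M, hM⟩ := h T hT
  refine ⟨M, fun x t ht => ?_⟩
  rw [pdx_reflect, pdx_neg_reflect, abs_neg]
  exact hM (-x) t ht

lemma fwdGrad_reflect (K γ : ℝ) (τ u : ℝ → ℝ → ℝ) (x t : ℝ) :
    fwdGrad K γ (fun x t => τ (-x) t) (fun x t => -u (-x) t) x t =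
      pdx u (-x) t + speed K γ τ (-x) t * pdx τ (-x) t := by
  rw [fwdGrad, pdx_reflect, pdx_neg_reflect]
  simp only [speed]
  ring

namespace IsSol

variable {K γ α lam C₀ : ℝ} {τ u : ℝ → ℝ → ℝ}

lemma exists_riccatiVar_le (h : IsSol K γ α lam τ u) (hK : 0 < K) (hγ1 : 1 < γ) (hγ3 : γ < 3)
    (hα : 0 ≤ α) (hlam : α * (γ - 1) / (γ - 3) ≤ lam) (hC₀ : 0 < C₀)
    (hdata : BoundedData C₀ τ u) (hgrad : GradBounded τ u)
    {E : ℝ → ℝ} (hE : Continuous E) (hE0 : E 0 = 1) (hE1 : ∀ t, 0 ≤ t → 1 ≤ E t)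
    (hE' : ∀ t, 0 < t → HasDerivAt E ((3 * γ - 1) / (2 * (3 - γ)) * damping α lam t * E t) t) :
    ∃ V > 0, ∀ x t, 0 ≤ t → riccatiVar K γ α lam τ u E x t ≤ V := by
  have h3 : 0 < 3 - γ := by linarith
  set L := √(K * γ) * C₀⁻¹ ^ (-(γ + 1) / 2)
  set V := C₀⁻¹ ^ (-((γ + 1) / 4)) * (C₀ + L * C₀ + 2 / (3 - γ) * α * C₀)
  have hinv : 0 < C₀⁻¹ := inv_pos.2 hC₀
  have hV : 0 < V := by
    have := rpow_pos_of_pos hinv (-((γ + 1) / 4))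
    positivity
  have hinit : ∀ x, riccatiVar K γ α lam τ u E x 0 ≤ V := by
    intro x
    have hpos := h.pos x le_rfl
    rw [riccatiVar, hE0, div_one, damping_zero]
    have h1 : |speed K γ τ x 0| ≤ L := h.speed_le hγ1 le_rfl hinv (hdata.lt_tau x).le
    have h2 : |speed K γ τ x 0 * pdx τ x 0| ≤ L * C₀ := by
      rw [abs_mul]
      exact mul_le_mul h1 (hdata.taux_le x) (abs_nonneg _) ((abs_nonneg _).trans h1)
    have h4 : 2 / (3 - γ) * α * τ x 0 ≤ 2 / (3 - γ) * α * C₀ :=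
      mul_le_mul_of_nonneg_left (hdata.tau_le x) (by positivity)
    have h5 : fwdGrad K γ τ u x 0 + 2 / (3 - γ) * α * τ x 0 ≤
        C₀ + L * C₀ + 2 / (3 - γ) * α * C₀ := by
      rw [fwdGrad]
      linarith [(abs_le.1 (hdata.ux_le x)).2, (abs_le.1 h2).1]
    refine (mul_le_mul_of_nonneg_left h5 (rpow_nonneg hpos.le _)).trans
      (mul_le_mul_of_nonneg_right
        (rpow_le_rpow_of_nonpos hinv (hdata.lt_tau x).le (by linarith)) (by positivity))
  refine ⟨V, hV, fun x t ht => ?_⟩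
  rcases ht.eq_or_lt with rfl | htpos
  · exact hinit x
  obtain ⟨M, hM⟩ := hgrad t htpos
  obtain ⟨δ, hδ, hlow⟩ := h.exists_tau_lower_bound hK hγ1 hα hC₀ hdata.u_le hdata.lt_tau
    (fun x s hs => (hM x s hs).2)
  obtain ⟨X, hXt, hX, hX'⟩ := h.exists_characteristic hγ1 hδ hlow (fun x s hs => (hM x s hs).1)
    (right_mem_Icc.2 ht) x
  have := h.antitoneOn_riccatiVar hK hγ1 hγ3 hα hlam hδ hlow (fun x s hs => (hM x s hs).1)
    (fun x s hs => (hM x s hs).2) hE hE1 hE' hX hX' (left_mem_Icc.2 ht) (right_mem_Icc.2 ht) ht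
  simp only [hXt] at this
  exact this.trans (hinit _)

/-- The specific volume grows at most like a power of the antiderivative `H` of the integrating
factor. -/
lemma exists_rpow_tau_le (h : IsSol K γ α lam τ u) (hK : 0 < K) (hγ1 : 1 < γ) (hγ3 : γ < 3)
    (hα : 0 ≤ α) (hlam : α * (γ - 1) / (γ - 3) ≤ lam) (hC₀ : 0 < C₀)
    (hdata : BoundedData C₀ τ u) (hgrad : GradBounded τ u)
    {E H : ℝ → ℝ} (hE : Continuous E) (hE0 : E 0 = 1) (hE1 : ∀ t, 0 ≤ t → 1 ≤ E t)
    (hE' : ∀ t, 0 < t → HasDerivAt E ((3 * γ - 1) / (2 * (3 - γ)) * damping α lam t * E t) t)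
    (hH0 : H 0 = 0) (hH : ∀ t, HasDerivAt H (E t) t) :
    ∃ b > 0, ∃ m > 0, ∀ x t, 0 ≤ t → τ x t ^ ((3 - γ) / 4) ≤ b + m * H t := by
  have h3 : 0 < 3 - γ := by linarith
  obtain ⟨V₁, hV₁, hle₁⟩ :=
    h.exists_riccatiVar_le hK hγ1 hγ3 hα hlam hC₀ hdata hgrad hE hE0 hE1 hE'
  obtain ⟨V₂, hV₂, hle₂⟩ := h.reflect.exists_riccatiVar_le hK hγ1 hγ3 hα hlam hC₀
    hdata.reflect hgrad.reflect hE hE0 hE1 hE'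
  refine ⟨C₀ ^ ((3 - γ) / 4), rpow_pos_of_pos hC₀ _, (3 - γ) / 4 * ((V₁ + V₂) / 2), by positivity,
    fun x t ht => ?_⟩
  have hux : ∀ r, 0 ≤ r → τ x r ^ (-((γ + 1) / 4)) * pdx u x r ≤ (V₁ + V₂) / 2 * E r := by
    intro r hr
    have e1 := hle₁ x r hr
    have e2 := hle₂ (-x) r hr
    have hEr := zero_lt_one.trans_le (hE1 r hr)
    rw [riccatiVar, div_le_iff₀ hEr] at e1 e2
    rw [fwdGrad_reflect] at e2
    simp only [neg_neg] at e2
    rw [fwdGrad] at e1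
    have hτ := h.pos x hr
    have hw := rpow_pos_of_pos hτ (-((γ + 1) / 4))
    have ha := damping_nonneg (lam := lam) hα hr
    have : 0 ≤ τ x r ^ (-((γ + 1) / 4)) * (2 / (3 - γ) * damping α lam r * τ x r) := by positivity
    linarith
  have hanti : AntitoneOn (fun r => τ x r ^ ((3 - γ) / 4) -
      (3 - γ) / 4 * ((V₁ + V₂) / 2) * H r) (Icc 0 t) := by
    have hd : ∀ r ∈ Icc 0 t, HasDerivAt (fun r => τ x r ^ ((3 - γ) / 4) -
        (3 - γ) / 4 * ((V₁ + V₂) / 2) * H r)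
        (pdx u x r * ((3 - γ) / 4) * τ x r ^ ((3 - γ) / 4 - 1) -
          (3 - γ) / 4 * ((V₁ + V₂) / 2) * E r) r := fun r hr => by
      have := hasDerivAt_pdt h.1 x r
      rw [h.pdt_tau x hr.1] at this
      exact (this.rpow_const (Or.inl (h.pos x hr.1).ne')).sub ((hH r).const_mul _)
    refine antitoneOn_of_deriv_nonpos (convex_Icc 0 t)
      (fun r hr => (hd r hr).continuousAt.continuousWithinAt)
      (fun r hr => (hd r (interior_subset hr)).differentiableAt.differentiableWithinAt)
      (fun r hr => ?_)
    rw [(hd r (interior_subset hr)).deriv, show (3 - γ) / 4 - 1 = -((γ + 1) / 4) by ring]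
    have := mul_le_mul_of_nonneg_left (hux r (interior_subset hr).1)
      (show 0 ≤ (3 - γ) / 4 by positivity)
    linarith
  have h1 := hanti (left_mem_Icc.2 ht) (right_mem_Icc.2 ht) ht
  simp only [hH0, mul_zero, sub_zero] at h1
  have h2 : τ x 0 ^ ((3 - γ) / 4) ≤ C₀ ^ ((3 - γ) / 4) :=
    rpow_le_rpow (h.pos x le_rfl).le (hdata.tau_le x) (by positivity)
  linarith

/-- A global solution with gradient bounded on strips cannot have a strongly compressive forward
wave. -/
lemma not_compressive (h : IsSol K γ α lam τ u) (hK : 0 < K) (hγ1 : 1 < γ) (hγ3 : γ < 3)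
    (hα : 0 ≤ α) (hlam : α * (γ - 1) / (γ - 3) ≤ lam) (hC₀ : 0 < C₀)
    (hdata : BoundedData C₀ τ u) (hgrad : GradBounded τ u) (x₀ : ℝ) :
    0 ≤ fwdGrad K γ τ u x₀ 0 + 2 / (3 - γ) * α * τ x₀ 0 := by
  by_contra! hneg
  have h3 : 0 < 3 - γ := by linarith
  have hγ' : 0 < γ + 1 := by linarith
  obtain ⟨E, H, hE, hE0, hH0, hE1, hE', hH, hHt⟩ := exists_integrating_factor
    (μ := (3 * γ - 1) / (2 * (3 - γ))) (div_nonneg (by linarith) (by linarith))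
    (continuousOn_damping (α := α) (lam := lam)) (fun t ht => damping_nonneg hα ht)
  obtain ⟨b, hb, m, hm, hτle⟩ :=
    h.exists_rpow_tau_le hK hγ1 hγ3 hα hlam hC₀ hdata hgrad hE hE0 hE1 hE' hH0 hH
  set v₀ := riccatiVar K γ α lam τ u E x₀ 0 with hv₀
  have hv₀neg : v₀ < 0 := by
    rw [hv₀, riccatiVar, hE0, div_one, damping_zero]
    exact mul_neg_of_pos_of_neg (rpow_pos_of_pos (h.pos x₀ le_rfl) _) hneg
  have hWpos : ∀ t, 0 ≤ t → 0 < b + m * H t := fun t ht => by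
    have := ht.trans (hHt t ht)
    positivity
  have hbound : ∀ T > 0, (γ + 1) / 4 / m * log (b + m * H T) ≤
      (γ + 1) / 4 / m * log b - v₀⁻¹ := by
    intro T hT
    obtain ⟨M, hM⟩ := hgrad T hT
    have hτM : ∀ x, ∀ s ∈ Icc 0 T, |pdx τ x s| ≤ M := fun x s hs => (hM x s hs).1
    have huM : ∀ x, ∀ s ∈ Icc 0 T, |pdx u x s| ≤ M := fun x s hs => (hM x s hs).2
    obtain ⟨δ, hδ, hlow⟩ := h.exists_tau_lower_bound hK hγ1 hα hC₀ hdata.u_le hdata.lt_tau huM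
    obtain ⟨X, hX0, hX, hX'⟩ := h.exists_characteristic hγ1 hδ hlow hτM
      (left_mem_Icc.2 hT.le) x₀
    have hanti := h.antitoneOn_riccatiVar hK hγ1 hγ3 hα hlam hδ hlow hτM huM hE hE1 hE' hX hX'
    have hd := h.riccatiVar_along hK hγ1 hγ3 hα hlam hδ hlow hτM huM hE1 hE' hX hX'
    have hcont := h.continuousOn_riccatiVar hE hE1 hX
    set v : ℝ → ℝ := fun r => riccatiVar K γ α lam τ u E (X r) r with hv
    have hv0 : v 0 = v₀ := by rw [hv₀, ← hX0]
    have hvneg : ∀ r ∈ Icc 0 T, v r < 0 := fun r hr =>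
      (hanti (left_mem_Icc.2 hT.le) hr hr.1).trans_lt (hv0 ▸ hv₀neg)
    have hWd : ∀ r, 0 ≤ r → HasDerivAt (fun r => (γ + 1) / 4 / m * log (b + m * H r))
        ((γ + 1) / 4 / m * (m * E r / (b + m * H r))) r := fun r hr =>
      ((((hH r).const_mul m).const_add b).log (hWpos r hr).ne').const_mul _
    have hmono : MonotoneOn (fun r => (v r)⁻¹ - (γ + 1) / 4 / m * log (b + m * H r)) (Icc 0 T) := by
      have hder : ∀ r ∈ Ioo 0 T, ∃ w, 0 ≤ w ∧
          HasDerivAt (fun r => (v r)⁻¹ - (γ + 1) / 4 / m * log (b + m * H r)) w r := by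
        intro r hr
        obtain ⟨v', hv', hle⟩ := hd r hr
        have hvr := hvneg r (Ioo_subset_Icc_self hr)
        refine ⟨_, ?_, (hv'.inv hvr.ne).sub (hWd r hr.1.le)⟩
        have hEr := zero_lt_one.trans_le (hE1 r hr.1.le)
        have hτr := h.pos (X r) hr.1.le
        have hinv : (b + m * H r)⁻¹ ≤ τ (X r) r ^ ((γ + 1) / 4 - 1) := by
          rw [show (γ + 1) / 4 - 1 = -((3 - γ) / 4) by ring, rpow_neg hτr.le]
          exact inv_anti₀ (rpow_pos_of_pos hτr _) (hτle _ _ hr.1.le)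
        have hv2 : 0 < v r ^ 2 := sq_pos_of_neg hvr
        have h1 : (γ + 1) / 4 / m * (m * E r / (b + m * H r)) =
            (γ + 1) / 4 * (b + m * H r)⁻¹ * E r := by
          field_simp
        rw [sub_nonneg, h1, le_div_iff₀ hv2]
        have h2 : (γ + 1) / 4 * (b + m * H r)⁻¹ * E r * v r ^ 2 ≤
            (γ + 1) / 4 * τ (X r) r ^ ((γ + 1) / 4 - 1) * E r * v r ^ 2 := by gcongr
        linarith
      refine monotoneOn_of_deriv_nonneg (convex_Icc 0 T)
        ((hcont.inv₀ fun r hr => (hvneg r hr).ne).sub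
          fun r hr => (hWd r hr.1).continuousAt.continuousWithinAt) (fun r hr => ?_) (fun r hr => ?_)
      · rw [interior_Icc] at hr
        obtain ⟨w, -, hw⟩ := hder r hr
        exact hw.differentiableAt.differentiableWithinAt
      · rw [interior_Icc] at hr
        obtain ⟨w, hw0, hw⟩ := hder r hr
        rwa [hw.deriv]
    have h1 := hmono (left_mem_Icc.2 hT.le) (right_mem_Icc.2 hT.le) hT.le
    simp only [hv0, hH0, mul_zero, add_zero] at h1
    have h2 := inv_lt_zero.2 (hvneg T (right_mem_Icc.2 hT.le))
    linarith
  have hlim : Tendsto (fun T => (γ + 1) / 4 / m * log (b + m * T)) atTop atTop :=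
    (tendsto_log_atTop.comp
      (tendsto_atTop_add_const_left _ b (tendsto_id.const_mul_atTop hm))).const_mul_atTop
      (by positivity)
  obtain ⟨T, hT, hTpos⟩ := ((hlim.eventually_gt_atTop
    ((γ + 1) / 4 / m * log b - v₀⁻¹)).and (eventually_gt_atTop 0)).exists
  have h4 : log (b + m * T) ≤ log (b + m * H T) :=
    log_le_log (by positivity) (by gcongr; exact hHt T hTpos.le)
  have h5 := mul_le_mul_of_nonneg_left h4 (show 0 ≤ (γ + 1) / 4 / m by positivity)
  linarith [hbound T hTpos]

lemma threshold_eq (h : IsSol K γ α lam τ u) (hK : 0 < K) (hγ1 : 1 < γ) (hγ3 : γ < 3) (x : ℝ) :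
    α * (γ - 1) / (Kc K γ * (3 - γ)) * Phi K γ τ x 0 ^ (-2 / (γ - 1)) =
      2 / (3 - γ) * α * τ x 0 := by
  have hγ' : 0 < γ - 1 := by linarith
  have h3 : 0 < 3 - γ := by linarith
  have hτ := h.pos x le_rfl
  have hk : 0 < √(K * γ) := sqrt_pos.2 (by positivity)
  set k := √(K * γ) with hkdef
  have hB : 0 < 2 * k / (γ - 1) := by positivity
  have hphi : Phi K γ τ x 0 ^ (-2 / (γ - 1)) =
      (2 * k / (γ - 1)) ^ (-2 / (γ - 1)) * τ x 0 := by
    rw [Phi, mul_rpow hB.le (rpow_nonneg hτ.le _), ← rpow_mul hτ.le,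
      show -(γ - 1) / 2 * (-2 / (γ - 1)) = 1 by field_simp, rpow_one]
  have hKc : Kc K γ = k * (2 * k / (γ - 1)) ^ (-2 / (γ - 1)) * (2 * k / (γ - 1))⁻¹ := by
    rw [Kc, Ktau, ← hkdef, ← rpow_mul hB.le, mul_assoc k, ← div_eq_mul_inv, ← rpow_sub_one hB.ne']
    congr 2
    field_simp
    ring
  have hw : 0 < (2 * k / (γ - 1)) ^ (-2 / (γ - 1)) := rpow_pos_of_pos hB _
  rw [hphi, hKc]
  generalize (2 * k / (γ - 1)) ^ (-2 / (γ - 1)) = w at *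
  field_simp

end IsSol

theorem stmt0 (K γ α lam C₀ : ℝ) (hK : 0 < K) (hγ1 : 1 < γ) (hγ3 : γ < 3)
    (hα : 0 ≤ α) (hlam : α * (γ - 1) / (γ - 3) ≤ lam) (hC₀ : 0 < C₀)
    (τ₀ u₀ : ℝ → ℝ) (hτ₀C : ContDiff ℝ 1 τ₀) (hu₀C : ContDiff ℝ 1 u₀)
    (hu₀ : ∀ x, |u₀ x| ≤ C₀ ∧ |deriv u₀ x| ≤ C₀)
    (hτ₀b : ∀ x, |τ₀ x| ≤ C₀ ∧ |deriv τ₀ x| ≤ C₀)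
    (hτ₀ : ∀ x, C₀⁻¹ < τ₀ x)
    (τ u : ℝ → ℝ → ℝ) (hsol : IsSol K γ α lam τ u)
    (hinit : ∀ x, τ x 0 = τ₀ x ∧ u x 0 = u₀ x)
    (x₀ : ℝ)
    (hcomp :
      pdx u x₀ 0 + pdx (Phi K γ τ) x₀ 0 <
        -(α * (γ - 1) / (Kc K γ * (3 - γ))) * Phi K γ τ x₀ 0 ^ (-2 / (γ - 1)) ∨
      pdx u x₀ 0 - pdx (Phi K γ τ) x₀ 0 <
        -(α * (γ - 1) / (Kc K γ * (3 - γ))) * Phi K γ τ x₀ 0 ^ (-2 / (γ - 1))) :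
    BlowsUp τ u := by
  by_contra hnb
  have hgrad := gradBounded_of_not_blowsUp hnb
  have hτ' : ∀ x, pdx τ x 0 = deriv τ₀ x := fun x => by
    rw [pdx, show (fun y => τ y 0) = τ₀ from funext fun y => (hinit y).1]
  have hu' : ∀ x, pdx u x 0 = deriv u₀ x := fun x => by
    rw [pdx, show (fun y => u y 0) = u₀ from funext fun y => (hinit y).2]
  have hdata : BoundedData C₀ τ u :=
    { u_le := fun x => by rw [(hinit x).2]; exact (hu₀ x).1
      ux_le := fun x => by rw [hu']; exact (hu₀ x).2
      tau_le := fun x => by rw [(hinit x).1]; exact (le_abs_self _).trans (hτ₀b x).1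
      taux_le := fun x => by rw [hτ']; exact (hτ₀b x).2
      lt_tau := fun x => by rw [(hinit x).1]; exact hτ₀ x }
  have hphi : pdx (Phi K γ τ) x₀ 0 = -speed K γ τ x₀ 0 * pdx τ x₀ 0 :=
    (hsol.phi_pdx hγ1 x₀ le_rfl).deriv
  rw [neg_mul, hsol.threshold_eq hK hγ1 hγ3, hphi] at hcomp
  rcases hcomp with hc | hc
  · have := hsol.not_compressive hK hγ1 hγ3 hα hlam hC₀ hdata hgrad x₀
    rw [fwdGrad] at this
    linarith
  · have := hsol.reflect.not_compressive hK hγ1 hγ3 hα hlam hC₀ hdata.reflect hgrad.reflect (-x₀)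
    rw [fwdGrad_reflect] at this
    simp only [neg_neg] at this
    linarith
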